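/- arXiv:math/9910131 — 2 statements merged into one kernel-verified Lean document; each statement's English description precedes it below -/
import Mathlib

section
/- Let R be a unital ring and let a, x, b be elements of R with a x + b = 1, where x ∈ cl(R_q^{-1}). Then there exists y in R such that a + b y is quasi-invertible. -/
/-- `x` and `y` are centrally orthogonal: `x r y = 0` and `y r x = 0` for all `r`. -/
def CentOrth {R : Type*} [Ring R] (x y : R) : Prop :=
  ∀ r : R, x * r * y = 0 ∧ y * r * x = 0

/-- `u` is quasi-invertible: `(1 - u a) ⊥ (1 - b u)` for some `a, b`. -/
def QuasiInv {R : Type*} [Ring R] (u : R) : Prop :=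
  ∃ a b : R, CentOrth (1 - u * a) (1 - b * u)

/-- `qcl A` is the set of `a` such that whenever `x a + b = 1`, some `a + y b` lies in `A`. -/
def qcl {R : Type*} [Ring R] (A : Set R) : Set R :=
  {a : R | ∀ x b : R, x * a + b = 1 → ∃ y : R, a + y * b ∈ A}

theorem CentOrth.symm {R : Type*} [Ring R] {x y : R} (h : CentOrth x y) : CentOrth y x :=
  fun r => ⟨(h r).2, (h r).1⟩

/-- Central orthogonality passes to elements of the generated two-sided ideals. -/
theorem CentOrth.mul_mul {R : Type*} [Ring R] {x y : R} (h : CentOrth x y) (c d e f : R) :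
    CentOrth (c * x * d) (e * y * f) := by
  intro r
  constructor
  · calc c * x * d * r * (e * y * f) = c * (x * (d * r * e) * y) * f := by noncomm_ring
      _ = 0 := by rw [(h _).1, mul_zero, zero_mul]
  · calc e * y * f * r * (c * x * d) = e * (y * (f * r * c) * x) * d := by noncomm_ring
      _ = 0 := by rw [(h _).2, mul_zero, zero_mul]

/-- A quasi-invertible element admits a single two-sided quasi-inverse. -/
theorem QuasiInv.exists_quasiInverse {R : Type*} [Ring R] {u : R} (hu : QuasiInv u) :
    ∃ v : R, CentOrth (1 - u * v) (1 - v * u) := by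
  obtain ⟨a, b, hab⟩ := hu
  refine ⟨a + b - a * u * b, ?_⟩
  have h := hab.mul_mul 1 (1 - u * b) (1 - a * u) 1
  have h₁ : 1 - u * (a + b - a * u * b) = 1 * (1 - u * a) * (1 - u * b) := by noncomm_ring
  have h₂ : 1 - (a + b - a * u * b) * u = (1 - a * u) * (1 - b * u) * 1 := by noncomm_ring
  rwa [h₁, h₂]

/-- Lemma 3.5: if `a x + b = 1` with `x ∈ cl(R_q⁻¹)`, then `a + b y` is
quasi-invertible for some `y`. -/
theorem lemma_3_5 {R : Type*} [Ring R] (a x b : R)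
    (hx : x ∈ qcl {u : R | QuasiInv u}) (h : a * x + b = 1) :
    ∃ y : R, QuasiInv (a + b * y) := by
  obtain ⟨y, hy⟩ := hx a b h
  obtain ⟨v, hv⟩ := QuasiInv.exists_quasiInverse hy
  obtain rfl : b = 1 - a * x := eq_sub_of_add_eq' h
  refine ⟨v * (1 - y * a), x + (1 - x * a) * y, x + (1 - x * a) * y, ?_⟩
  have h₁ : 1 - (a + (1 - a * x) * (v * (1 - y * a))) * (x + (1 - x * a) * y) =
      (1 - a * x) * (1 - v * (x + y * (1 - a * x))) * (1 - a * y) := by noncomm_ring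
  have h₂ : 1 - (x + (1 - x * a) * y) * (a + (1 - a * x) * (v * (1 - y * a))) =
      (1 - x * a) * (1 - (x + y * (1 - a * x)) * v) * (1 - y * a) := by noncomm_ring
  rw [h₁, h₂]
  exact hv.symm.mul_mul _ _ _ _
end

section
/- Let A be a unital C*-algebra and let x ∈ A. Then x lies in the norm closure of the set A_q^{-1} of quasi-invertible elements of A if and only if x ∈ cl(A_q^{-1}), i.e. for all a, b in A with a x + b = 1 there exists y in A such that x + y b is quasi-invertible. Consequently, A is extremally rich (A_q^{-1} is dense in A) if and only if A is a QB-ring. -/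
theorem QuasiInv.unit_mul {R : Type*} [Ring R] {u : R} (h : QuasiInv u) (w : Rˣ) :
    QuasiInv (w * u) := by
  obtain ⟨a, b, hab⟩ := h
  have e₁ : 1 - (w : R) * u * (a * ↑w⁻¹) = w * (1 - u * a) * ↑w⁻¹ := by
    simp [mul_sub, sub_mul, mul_assoc]
  have e₂ : 1 - b * ↑w⁻¹ * (w * u) = 1 - b * u := by simp [mul_assoc]
  refine ⟨a * ↑w⁻¹, b * ↑w⁻¹, fun r => ?_⟩
  rw [e₁, e₂]
  constructor
  · have := (hab (↑w⁻¹ * r)).1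
    simp only [mul_assoc] at this ⊢
    rw [this, mul_zero]
  · have := (hab (r * w)).2
    simp only [← mul_assoc] at this ⊢
    rw [this, zero_mul]

theorem QuasiInv.mul_unit {R : Type*} [Ring R] {u : R} (h : QuasiInv u) (w : Rˣ) :
    QuasiInv (u * w) := by
  obtain ⟨a, b, hab⟩ := h
  have e₁ : 1 - u * w * (↑w⁻¹ * a) = 1 - u * a := by simp [mul_assoc]
  have e₂ : 1 - ↑w⁻¹ * b * (u * w) = ↑w⁻¹ * (1 - b * u) * w := by
    simp [mul_sub, sub_mul, mul_assoc]
  refine ⟨↑w⁻¹ * a, ↑w⁻¹ * b, fun r => ?_⟩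
  rw [e₁, e₂]
  constructor
  · have := (hab (r * ↑w⁻¹)).1
    simp only [← mul_assoc] at this ⊢
    rw [this, zero_mul]
  · have := (hab (w * r)).2
    simp only [mul_assoc] at this ⊢
    rw [this, mul_zero]

/-- In a normed ring with summable geometric series, the closure of the quasi-invertible elements
lies in their `qcl`. -/
theorem closure_quasiInv_subset_qcl {R : Type*} [NormedRing R] [HasSummableGeomSeries R] :
    closure {u : R | QuasiInv u} ⊆ qcl {u : R | QuasiInv u} := by
  intro x hx a b hab
  have hε : (0 : ℝ) < 1 / (‖a‖ + 1) := by positivity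
  obtain ⟨u, hu, hxu⟩ := Metric.mem_closure_iff.mp hx _ hε
  rw [dist_eq_norm, lt_div_iff₀ (by positivity)] at hxu
  have hlt : ‖a‖ * ‖x - u‖ < 1 := by nlinarith [norm_nonneg (x - u)]
  let w := Units.oneSub ((x - u) * a)
    ((norm_mul_le _ _).trans_lt (by rwa [mul_comm] at hlt))
  have hw : (w : R) = 1 - (x - u) * a := rfl
  refine ⟨-(↑w⁻¹ * (x - u)), ?_⟩
  have key : x + -(↑w⁻¹ * (x - u)) * b = ↑w⁻¹ * u := by
    rw [← w.mul_right_inj, mul_add, neg_mul, mul_neg, mul_assoc, w.mul_inv_cancel_left,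
      w.mul_inv_cancel_left, hw, eq_sub_of_add_eq' hab]
    noncomm_ring
  rw [key]
  exact QuasiInv.unit_mul hu _

/-- A cut-off of the functional calculus of `star x * x`: the elements `1 - g * (star x * x)` and
`1 - ε • g` annihilate each other, while `ε • (x * g)` is small. -/
theorem exists_cutoff {A : Type*} [CStarAlgebra A] (x : A) {ε : ℝ} (hε : 0 < ε) :
    ∃ g : A, (1 - g * (star x * x)) * (1 - ε • g) = 0 ∧ ‖ε • (x * g)‖ ^ 2 ≤ ε ∧
      ∀ δ : ℝ, 0 < δ → IsUnit ((1 - ε • g) + algebraMap ℝ A δ) := by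
  have hmax (t : ℝ) : 0 < max t ε := lt_max_of_lt_right hε
  let f : ℝ → ℝ := fun t => (max t ε)⁻¹
  have hf : Continuous f :=
    Continuous.inv₀ (by fun_prop) fun t => (hmax t).ne'
  have hs : IsSelfAdjoint (star x * x) := .star_mul_self x
  have hfs : ContinuousOn f (spectrum ℝ (star x * x)) := hf.continuousOn
  have h₂ : 1 - ε • cfc f (star x * x) = cfc (fun t => 1 - ε * f t) (star x * x) := by
    rw [cfc_sub (fun _ => (1 : ℝ)) (fun t => ε * f t) (star x * x), cfc_const_one ℝ (star x * x),
      cfc_const_mul ε f (star x * x)]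
  refine ⟨cfc f (star x * x), ?_, ?_, fun δ hδ => ?_⟩
  · have h₁ : 1 - cfc f (star x * x) * (star x * x) =
        cfc (fun t => 1 - f t * t) (star x * x) := by
      rw [cfc_sub (fun _ => (1 : ℝ)) (fun t => f t * t) (star x * x),
        cfc_const_one ℝ (star x * x), cfc_mul f (fun t => t) (star x * x),
        cfc_id' ℝ (star x * x)]
    rw [h₁, h₂, ← cfc_mul (fun t => 1 - f t * t) (fun t => 1 - ε * f t) (star x * x)]
    rw [← cfc_const_zero ℝ (star x * x)]
    congr 1
    funext t
    rcases le_total t ε with h | h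
    · simp [f, max_eq_right h, hε.ne']
    · simp [f, max_eq_left h, (hε.trans_le h).ne']
  · have h₃ : star (ε • (x * cfc f (star x * x))) * (ε • (x * cfc f (star x * x))) =
        cfc (fun t => ε ^ 2 * (f t * t * f t)) (star x * x) := by
      rw [cfc_const_mul (ε ^ 2) (fun t => f t * t * f t) (star x * x),
        cfc_mul (fun t => f t * t) f (star x * x), cfc_mul f (fun t => t) (star x * x),
        cfc_id' ℝ (star x * x)]
      have : star (cfc f (star x * x)) = cfc f (star x * x) := cfc_predicate f (star x * x)
      rw [star_smul, star_mul, this]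
      simp [smul_smul, mul_assoc, sq]
    rw [sq, ← CStarRing.norm_star_mul_self, h₃]
    refine norm_cfc_le hε.le fun t ht => ?_
    have ht0 : 0 ≤ t := spectrum_star_mul_self_nonneg t ht
    have hm := hmax t
    have h1 : f t * t ≤ 1 := by
      rw [inv_mul_le_iff₀ hm, mul_one]; exact le_max_left _ _
    have h2 : ε * f t ≤ 1 := by
      rw [mul_inv_le_iff₀ hm, one_mul]; exact le_max_right _ _
    have h0 : 0 ≤ f t := (inv_pos.mpr hm).le
    rw [Real.norm_of_nonneg (by positivity)]
    calc ε ^ 2 * (f t * t * f t) = ε * ((f t * t) * (ε * f t)) := by ring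
      _ ≤ ε * (1 * 1) := by gcongr
      _ = ε := by ring
  · rw [h₂, ← cfc_const δ (star x * x), ← cfc_add _ (fun t => 1 - ε * f t) (fun _ => δ),
      isUnit_cfc_iff _ _]
    intro t _
    have h2 : ε * f t ≤ 1 := by
      rw [mul_inv_le_iff₀ (hmax t), one_mul]; exact le_max_right _ _
    linarith

/-- In a unital C*-algebra the `qcl` of the quasi-invertible elements lies in their closure. -/
theorem qcl_quasiInv_subset_closure {A : Type*} [CStarAlgebra A] :
    qcl {u : A | QuasiInv u} ⊆ closure {u : A | QuasiInv u} := by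
  intro x hx
  rw [Metric.mem_closure_iff]
  intro η hη
  obtain ⟨g, hg, hsmall, hunit⟩ := exists_cutoff x (ε := (η / 2) ^ 2) (by positivity)
  set ε := (η / 2) ^ 2
  obtain ⟨y, hy⟩ := hx (g * star x) (1 - g * (star x * x)) (by rw [mul_assoc]; abel)
  set u := x + y * (1 - g * (star x * x)) with hu
  have hδ : 0 < η / 2 / (‖u‖ + 1) := by positivity
  set δ := η / 2 / (‖u‖ + 1) with hδ_def
  obtain ⟨w, hw⟩ := hunit δ hδ
  refine ⟨u * w, QuasiInv.mul_unit hy w, ?_⟩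
  have huk : u * (1 - ε • g) = x * (1 - ε • g) := by
    rw [hu, add_mul, mul_assoc, hg, mul_zero, add_zero]
  have hdiff : x - u * w = ε • (x * g) - δ • u := by
    rw [hw, mul_add, huk, Algebra.algebraMap_eq_smul_one, mul_smul_comm, mul_one, mul_sub, mul_one,
      mul_smul_comm]
    abel
  have h₁ : ‖ε • (x * g)‖ ≤ η / 2 := le_of_sq_le_sq hsmall (by positivity)
  have h₂ : ‖δ • u‖ < η / 2 := by
    rw [norm_smul, Real.norm_of_nonneg hδ.le, hδ_def, div_mul_eq_mul_div,
      div_lt_iff₀ (by positivity)]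
    nlinarith
  rw [dist_eq_norm, hdiff]
  linarith [norm_sub_le (ε • (x * g)) (δ • u)]

/-- Proposition 9.1 and its consequence: in a unital C*-algebra, `cl(A_q⁻¹)` is the
norm closure of `A_q⁻¹`; hence `A` is extremally rich iff `A` is a QB-ring. -/
theorem cstar_qcl_eq_closure {A : Type*} [CStarAlgebra A] :
    (∀ x : A, x ∈ closure {u : A | QuasiInv u} ↔
      ∀ a b : A, a * x + b = 1 → ∃ y : A, QuasiInv (x + y * b)) ∧
    (closure {u : A | QuasiInv u} = Set.univ ↔
      qcl {u : A | QuasiInv u} = Set.univ) := by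
  have h : closure {u : A | QuasiInv u} = qcl {u : A | QuasiInv u} :=
    closure_quasiInv_subset_qcl.antisymm qcl_quasiInv_subset_closure
  exact ⟨fun x => Set.ext_iff.mp h x, by rw [h]⟩
end
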